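/- Let X be a countable subshift of finite type (SFT) over a finite alphabet A. Then X contains a configuration with no direction of periodicity (a configuration x such that σ_v x ≠ x for every nonzero v ∈ ℤ×ℤ) if and only if X contains a configuration at level 2 for ⪯. -/

import Mathlib

namespace CountableSubshift

/-- A configuration over alphabet `A` on the plane `ℤ × ℤ`. -/
abbrev Config (A : Type*) := ℤ × ℤ → A

variable {A : Type*}

/-- The shift by a vector `v`. -/
def shift (v : ℤ × ℤ) (x : Config A) : Config A := fun u => x (u + v)

/-- The shift-orbit of a configuration. -/
def orbit (x : Config A) : Set (Config A) := Set.range fun v => shift v x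

variable [TopologicalSpace A]

/-- `Preceq x y` iff `x` belongs to the closure of the shift-orbit of `y`. -/
def Preceq (x y : Config A) : Prop := x ∈ closure (orbit y)

/-- Strict version of `Preceq`. -/
def Prec (x y : Config A) : Prop := Preceq x y ∧ ¬ Preceq y x

/-- `x ≈ y` : mutual `Preceq`. -/
def OrbEquiv (x y : Config A) : Prop := Preceq x y ∧ Preceq y x

/-- A subshift: nonempty, closed and shift-invariant set of configurations. -/
def IsSubshift (X : Set (Config A)) : Prop :=
  X.Nonempty ∧ IsClosed X ∧ ∀ v : ℤ × ℤ, shift v '' X = X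

/-- A configuration is periodic if it has two linearly independent vectors of periodicity. -/
def Periodic (x : Config A) : Prop :=
  ∃ v w : ℤ × ℤ, shift v x = x ∧ shift w x = x ∧ LinearIndependent ℤ ![v, w]

/-- `x` is at level 0 in `X`: it is `Preceq`-minimal in `X`. -/
def Level0 (X : Set (Config A)) (x : Config A) : Prop :=
  x ∈ X ∧ ∀ y ∈ X, Preceq y x → Preceq x y

/-- `x` is at level 1 in `X`. -/
def Level1 (X : Set (Config A)) (x : Config A) : Prop :=
  x ∈ X ∧ ¬ Level0 X x ∧ ∀ y ∈ X, Prec y x → Level0 X y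

/-- `x` is at level 2 in `X`. -/
def Level2 (X : Set (Config A)) (x : Config A) : Prop :=
  x ∈ X ∧ ¬ Level0 X x ∧ ¬ Level1 X x ∧ ∀ y ∈ X, Prec y x → Level0 X y ∨ Level1 X y

/-- The pattern `p` with (finite) domain `D` appears in `x` at position `u`. -/
def AppearsAt (D : Finset (ℤ × ℤ)) (p : ℤ × ℤ → A) (x : Config A) (u : ℤ × ℤ) : Prop :=
  ∀ d ∈ D, x (u + d) = p d

/-- A subshift of finite type: the nonempty set of configurations avoiding a
finite family of forbidden patterns. -/
def IsSFT (X : Set (Config A)) : Prop :=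
  X.Nonempty ∧ ∃ (n : ℕ) (D : Fin n → Finset (ℤ × ℤ)) (p : Fin n → ℤ × ℤ → A),
    X = {x : Config A | ∀ (i : Fin n) (u : ℤ × ℤ), ¬ AppearsAt (D i) (p i) x u}

/-- Every pattern appearing in `c` appears at infinitely many positions. -/
def AllPatternsInfinite (c : Config A) : Prop :=
  ∀ (D : Finset (ℤ × ℤ)) (u : ℤ × ℤ),
    {u' : ℤ × ℤ | ∀ d ∈ D, c (u' + d) = c (u + d)}.Infinite

/-- The standard dot product on `ℤ × ℤ`. -/
def dot (u w : ℤ × ℤ) : ℤ := u.1 * w.1 + u.2 * w.2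

section Basic

theorem shift_shift {A : Type*} (a b : ℤ × ℤ) (x : Config A) :
    shift a (shift b x) = shift (a + b) x := by
  funext u
  simp only [shift, add_assoc]

theorem shift_zero {A : Type*} (x : Config A) : shift 0 x = x := by
  funext u
  simp [shift]

theorem shift_injective {A : Type*} (a : ℤ × ℤ) :
    Function.Injective (shift a : Config A → Config A) := fun x y h => by
  have := congrArg (shift (-a)) h
  simpa [shift_shift, shift_zero] using this

theorem shift_eq_self_iff {A : Type*} {v : ℤ × ℤ} {x : Config A} :
    shift v x = x ↔ ∀ u, x (u + v) = x u := by
  simp [funext_iff, shift]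

/-- A vector of periodicity can be used any integer number of times. -/
theorem apply_add_zsmul {A : Type*} {v : ℤ × ℤ} {x : Config A} (h : ∀ u, x (u + v) = x u)
    (k : ℤ) (u : ℤ × ℤ) : x (u + k • v) = x u := by
  induction k using Int.induction_on with
  | zero => simp
  | succ k ih => rw [add_smul, one_smul, ← add_assoc, h, ih]
  | pred k ih => rw [← ih, ← h, sub_smul, one_smul]; congr 1; abel

/-- `u` lies in the square of radius `n` around the origin. -/
def InBox (n : ℤ) (u : ℤ × ℤ) : Prop := (-n ≤ u.1 ∧ u.1 ≤ n) ∧ (-n ≤ u.2 ∧ u.2 ≤ n)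

theorem InBox.mono {m n : ℤ} (h : m ≤ n) {u : ℤ × ℤ} (hu : InBox m u) : InBox n u := by
  unfold InBox at *; omega

theorem InBox.add {m n : ℤ} {u v : ℤ × ℤ} (hu : InBox m u) (hv : InBox n v) :
    InBox (m + n) (u + v) := by
  simp only [InBox, Prod.fst_add, Prod.snd_add] at *; omega

theorem InBox.neg {n : ℤ} {u : ℤ × ℤ} (hu : InBox n u) : InBox n (-u) := by
  simp only [InBox, Prod.fst_neg, Prod.snd_neg] at *; omega

theorem InBox.smul {n : ℤ} {u : ℤ × ℤ} (hu : InBox n u) {k c : ℤ} (hk : |k| ≤ c) :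
    InBox (c * n) (k • u) := by
  have h1 : |u.1| ≤ n := abs_le.2 hu.1
  have h2 : |u.2| ≤ n := abs_le.2 hu.2
  have hc : 0 ≤ c := (abs_nonneg k).trans hk
  refine ⟨abs_le.1 ?_, abs_le.1 ?_⟩
  · simpa [abs_mul] using mul_le_mul hk h1 (abs_nonneg _) hc
  · simpa [abs_mul] using mul_le_mul hk h2 (abs_nonneg _) hc

theorem inBox_natAbs (u : ℤ × ℤ) : InBox ((u.1.natAbs + u.2.natAbs : ℕ) : ℤ) u := by
  unfold InBox; omega

theorem finite_inBox (n : ℤ) : {u | InBox n u}.Finite :=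
  ((Set.finite_Icc (-n) n).prod (Set.finite_Icc (-n) n)).subset fun _ hu => hu

theorem exists_inBox_of_finite {S : Set (ℤ × ℤ)} (hS : S.Finite) :
    ∃ n : ℕ, ∀ u ∈ S, InBox n u := by
  obtain ⟨n, hn⟩ := (hS.image fun u => u.1.natAbs + u.2.natAbs).bddAbove
  refine ⟨n, fun u hu => (inBox_natAbs u).mono ?_⟩
  exact_mod_cast hn (Set.mem_image_of_mem _ hu)

theorem preceq_shift (v : ℤ × ℤ) (x : Config A) : Preceq (shift v x) x :=
  subset_closure ⟨v, rfl⟩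

theorem preceq_refl (x : Config A) : Preceq x x :=
  subset_closure ⟨0, shift_zero x⟩

theorem preceq_of_mem_orbit {x y : Config A} (h : x ∈ orbit y) : Preceq y x := by
  obtain ⟨v, rfl⟩ := h
  have := preceq_shift (-v) (shift v y)
  rwa [shift_shift, neg_add_cancel, shift_zero] at this

theorem Preceq.mem {X : Set (Config A)} (hcl : IsClosed X)
    (hinv : ∀ v, ∀ x ∈ X, shift v x ∈ X) {x y : Config A} (hx : x ∈ X) (h : Preceq y x) :
    y ∈ X :=
  closure_minimal (by rintro _ ⟨v, rfl⟩; exact hinv v x hx) hcl h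

/-- A configuration that locally agrees with elements of an SFT belongs to it. -/
theorem IsSFT.exists_radius {A : Type*} {X : Set (Config A)} (hX : IsSFT X) :
    ∃ r : ℕ, ∀ z : Config A,
      (∀ u, ∃ x ∈ X, ∀ d, InBox r d → z (u + d) = x (u + d)) → z ∈ X := by
  obtain ⟨-, n, D, p, rfl⟩ := hX
  obtain ⟨r, hr⟩ := exists_inBox_of_finite
    (S := ⋃ i, (D i : Set (ℤ × ℤ))) (Set.finite_iUnion fun i => (D i).finite_toSet)
  refine ⟨r, fun z hz i u hiu => ?_⟩
  obtain ⟨x, hx, hzx⟩ := hz u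
  refine hx i u fun d hd => ?_
  rw [← hzx d (hr d (Set.mem_iUnion.2 ⟨i, hd⟩)), hiu d hd]

theorem IsSFT.shift_mem {A : Type*} {X : Set (Config A)} (hX : IsSFT X) (v : ℤ × ℤ) (x : Config A)
    (hx : x ∈ X) : shift v x ∈ X := by
  obtain ⟨-, n, D, p, rfl⟩ := hX
  intro i u h
  refine hx i (u + v) fun d hd => ?_
  rw [← h d hd, shift]
  congr 1
  abel

variable [DiscreteTopology A]

theorem mem_closure_iff_inBox {S : Set (Config A)} {x : Config A} :
    x ∈ closure S ↔ ∀ n : ℕ, ∃ z ∈ S, ∀ u, InBox n u → z u = x u := by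
  rw [mem_closure_iff]
  constructor
  · intro h n
    have ho : IsOpen (Set.pi {u | InBox n u} fun u => ({x u} : Set A)) :=
      isOpen_set_pi (finite_inBox n) fun _ _ => isOpen_discrete _
    obtain ⟨z, hz, hzS⟩ := h _ ho fun u _ => rfl
    exact ⟨z, hzS, fun u hu => hz u hu⟩
  · intro h o ho hx
    obtain ⟨I, t, ht, hIt⟩ := isOpen_pi_iff.1 ho x hx
    obtain ⟨n, hn⟩ := exists_inBox_of_finite I.finite_toSet
    obtain ⟨z, hzS, hz⟩ := h n
    exact ⟨z, hIt fun u hu => by rw [hz u (hn u hu)]; exact (ht u hu).2, hzS⟩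

theorem preceq_iff {x y : Config A} :
    Preceq x y ↔ ∀ n : ℕ, ∃ c, ∀ u, InBox n u → y (u + c) = x u := by
  simp [Preceq, mem_closure_iff_inBox, orbit, shift]

theorem preceq_trans {x y z : Config A} (h₁ : Preceq x y) (h₂ : Preceq y z) : Preceq x z := by
  rw [preceq_iff] at *
  intro n
  obtain ⟨c, hc⟩ := h₁ n
  obtain ⟨c', hc'⟩ := h₂ (n + (c.1.natAbs + c.2.natAbs))
  refine ⟨c + c', fun u hu => ?_⟩
  rw [← hc u hu, ← add_assoc]
  exact hc' _ (by exact_mod_cast hu.add (inBox_natAbs c))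

theorem IsSFT.isClosed {X : Set (Config A)} (hX : IsSFT X) : IsClosed X := by
  obtain ⟨r, hr⟩ := hX.exists_radius
  refine isClosed_of_closure_subset fun z hz => hr z fun u => ?_
  obtain ⟨x, hx, h⟩ := mem_closure_iff_inBox.1 hz (u.1.natAbs + u.2.natAbs + r)
  exact ⟨x, hx, fun d hd => (h _ (by exact_mod_cast (inBox_natAbs u).add hd)).symm⟩

end Basic

section Isolated

variable [DiscreteTopology A] [Finite A]

/-- A nonempty countable closed set of configurations has an isolated point. -/
theorem exists_isolated {Y : Set (Config A)} (hcl : IsClosed Y) (hcount : Y.Countable)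
    (hne : Y.Nonempty) :
    ∃ y ∈ Y, ∃ n : ℕ, ∀ z ∈ Y, (∀ u, InBox n u → z u = y u) → z = y := by
  have : CompactSpace Y := isCompact_iff_compactSpace.1 hcl.isCompact
  have : Countable Y := hcount.to_subtype
  have : Nonempty Y := hne.to_subtype
  obtain ⟨y, hy⟩ := nonempty_interior_of_iUnion_of_closed (f := fun y : Y => ({y} : Set Y))
    (fun y => isClosed_singleton) (by ext; simp)
  have hopen : IsOpen ({y} : Set Y) := by
    obtain ⟨z, hz⟩ := hy
    obtain rfl : z = y := by simpa using interior_subset hz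
    exact interior_eq_iff_isOpen.1
      (interior_subset.antisymm (Set.singleton_subset_iff.2 hz))
  obtain ⟨o, ho, hoy⟩ := isOpen_induced_iff.1 hopen
  refine ⟨y, y.2, ?_⟩
  have hyc : (y : Config A) ∉ closure oᶜ := by
    rw [ho.isClosed_compl.closure_eq]
    have : y ∈ (Subtype.val ⁻¹' o : Set Y) := by rw [hoy]; rfl
    simpa using this
  rw [mem_closure_iff_inBox] at hyc
  push Not at hyc
  obtain ⟨n, hn⟩ := hyc
  refine ⟨n, fun z hz hzy => ?_⟩
  by_contra hne
  have hzo : z ∈ oᶜ := fun hzo => by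
    have : (⟨z, hz⟩ : Y) ∈ ({y} : Set Y) := by rw [← hoy]; exact hzo
    exact hne (congrArg Subtype.val this)
  obtain ⟨u, hu, hzu⟩ := hn z hzo
  exact hzu (hzy u hu)

variable {X : Set (Config A)}

theorem isolated_in_orbit_closure (hcl : IsClosed X) (hinv : ∀ v, ∀ x ∈ X, shift v x ∈ X)
    (hcount : X.Countable) {y : Config A} (hy : y ∈ X) :
    ∃ n : ℕ, ∀ z, Preceq z y → (∀ u, InBox n u → z u = y u) → z = y := by
  obtain ⟨y₀, hy₀, n, hn⟩ := exists_isolated (Y := closure (orbit y)) isClosed_closure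
    (hcount.mono fun z hz => Preceq.mem hcl hinv hy hz) ⟨y, preceq_refl y⟩
  obtain ⟨_, ⟨c, rfl⟩, hc⟩ := mem_closure_iff_inBox.1 hy₀ n
  have hcy : shift c y = y₀ := hn _ (preceq_shift c y) hc
  refine ⟨n + (c.1.natAbs + c.2.natAbs), fun z hz hzy => shift_injective c ?_⟩
  rw [hcy]
  refine hn _ (preceq_trans (preceq_shift c z) hz) fun u hu => ?_
  rw [← hcy]
  exact hzy _ (by exact_mod_cast hu.add (inBox_natAbs c))

theorem mem_orbit_of_preceq_of_preceq (hcl : IsClosed X) (hinv : ∀ v, ∀ x ∈ X, shift v x ∈ X)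
    (hcount : X.Countable) {y z : Config A} (hy : y ∈ X) (hzy : Preceq z y)
    (hyz : Preceq y z) : z ∈ orbit y := by
  obtain ⟨n, hn⟩ := isolated_in_orbit_closure hcl hinv hcount hy
  obtain ⟨c, hc⟩ := preceq_iff.1 hyz n
  have h : shift c z = y := hn _ (preceq_trans (preceq_shift c z) hzy) hc
  exact ⟨-c, by simp only [← h, shift_shift, neg_add_cancel, shift_zero]⟩

theorem prec_iff (hcl : IsClosed X) (hinv : ∀ v, ∀ x ∈ X, shift v x ∈ X)
    (hcount : X.Countable) {y z : Config A} (hy : y ∈ X) : Prec z y ↔ Preceq z y ∧ z ∉ orbit y :=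
  ⟨fun h => ⟨h.1, fun ho => h.2 (preceq_of_mem_orbit ho)⟩,
    fun h => ⟨h.1, fun hyz => h.2 (mem_orbit_of_preceq_of_preceq hcl hinv hcount hy h.1 hyz)⟩⟩

/-- A sequence of translates of `y` that takes no value infinitely often accumulates at a
configuration strictly below `y`. -/
theorem exists_prec_accumulation (hcl : IsClosed X) (hinv : ∀ v, ∀ x ∈ X, shift v x ∈ X)
    (hcount : X.Countable) {y : Config A} (hy : y ∈ X) (c : ℕ → ℤ × ℤ)
    (hc : ∀ z, ∃ K, ∀ k ≥ K, shift (c k) y ≠ z) :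
    ∃ z, Prec z y ∧ ∀ n : ℕ, ∀ K, ∃ k ≥ K, ∀ u, InBox n u → y (u + c k) = z u := by
  obtain ⟨z, hz⟩ := exists_clusterPt_of_compactSpace
    (Filter.map (fun k => shift (c k) y) Filter.atTop)
  have hcluster : ∀ n : ℕ, ∀ K, ∃ k ≥ K, ∀ u, InBox n u → y (u + c k) = z u := by
    intro n K
    have ho : IsOpen (Set.pi {u | InBox n u} fun u => ({z u} : Set A)) :=
      isOpen_set_pi (finite_inBox n) fun _ _ => isOpen_discrete _
    have hfreq := (mapClusterPt_iff_frequently.1 hz) _ (ho.mem_nhds fun u _ => rfl)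
    obtain ⟨k, hk, h⟩ := Filter.frequently_atTop.1 hfreq K
    exact ⟨k, hk, fun u hu => h u hu⟩
  have hle : Preceq z y := preceq_iff.2 fun n => by
    obtain ⟨k, -, h⟩ := hcluster n 0
    exact ⟨c k, h⟩
  refine ⟨z, ⟨hle, fun hyz => ?_⟩, hcluster⟩
  obtain ⟨n, hn⟩ := isolated_in_orbit_closure hcl hinv hcount
    (Preceq.mem hcl hinv hy hle)
  obtain ⟨K, hK⟩ := hc z
  obtain ⟨k, hk, h⟩ := hcluster n K
  exact hK k hk (hn _ (preceq_trans (preceq_shift _ _) hyz) h)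

end Isolated

section DoublyPeriodic

/-- `x` has a horizontal and a vertical period, both of length `M`. -/
def BiPeriodic {A : Type*} (M : ℤ) (x : Config A) : Prop :=
  0 < M ∧ (∀ u, x (u + (M, 0)) = x u) ∧ ∀ u, x (u + (0, M)) = x u

theorem BiPeriodic.apply_add {A : Type*} {M : ℤ} {x : Config A} (h : BiPeriodic M x) (a b : ℤ)
    (u : ℤ × ℤ) : x (u + (M * a, M * b)) = x u := by
  rw [← apply_add_zsmul h.2.1 a u, ← apply_add_zsmul h.2.2 b (u + a • (M, 0))]
  congr 1
  ext <;> simp [mul_comm]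

theorem BiPeriodic.finite_orbit {A : Type*} {M : ℤ} {x : Config A} (h : BiPeriodic M x) :
    (orbit x).Finite := by
  refine ((finite_inBox M).image fun v => shift v x).subset ?_
  rintro _ ⟨v, rfl⟩
  have hM := h.1
  refine ⟨(v.1 % M, v.2 % M), ?_, ?_⟩
  · have := Int.emod_nonneg v.1 hM.ne'
    have := Int.emod_nonneg v.2 hM.ne'
    have := Int.emod_lt_of_pos v.1 hM
    have := Int.emod_lt_of_pos v.2 hM
    simp only [InBox, Set.mem_ofPred_eq]
    omega
  · funext u
    simp only [shift]
    rw [← h.apply_add (v.1 / M) (v.2 / M)]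
    congr 1
    have := Int.emod_add_mul_ediv v.1 M
    have := Int.emod_add_mul_ediv v.2 M
    ext
    · simp only [Prod.fst_add]; linarith
    · simp only [Prod.snd_add]; linarith

theorem BiPeriodic.shift {A : Type*} {M : ℤ} {x : Config A} (h : BiPeriodic M x) (v : ℤ × ℤ) :
    BiPeriodic M (shift v x) := by
  refine ⟨h.1, fun u => ?_, fun u => ?_⟩
  · simpa only [CountableSubshift.shift, add_right_comm] using h.2.1 (u + v)
  · simpa only [CountableSubshift.shift, add_right_comm] using h.2.2 (u + v)

theorem BiPeriodic.level0 [DiscreteTopology A] {X : Set (Config A)} {M : ℤ} {x : Config A}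
    (h : BiPeriodic M x) (hx : x ∈ X) : Level0 X x := by
  refine ⟨hx, fun y _ hyx => preceq_of_mem_orbit ?_⟩
  rwa [Preceq, h.finite_orbit.isClosed.closure_eq] at hyx

theorem Level0.exists_period [DiscreteTopology A] [Finite A] {X : Set (Config A)}
    (hcl : IsClosed X) (hinv : ∀ v, ∀ x ∈ X, CountableSubshift.shift v x ∈ X)
    (hcount : X.Countable) {y : Config A} (h : Level0 X y) (e : ℤ × ℤ) :
    ∃ k : ℤ, 0 < k ∧ ∀ u, y (u + k • e) = y u := by
  by_contra! hcon
  obtain ⟨z, hz, -⟩ := exists_prec_accumulation hcl hinv hcount h.1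
    (fun k : ℕ => (k : ℤ) • e) (fun z => by
      by_cases hz : ∃ k : ℕ, CountableSubshift.shift ((k : ℤ) • e) y = z
      · obtain ⟨k, rfl⟩ := hz
        refine ⟨k + 1, fun l hl heq => ?_⟩
        obtain ⟨u, hu⟩ := hcon ((l : ℤ) - k) (by omega)
        refine hu (shift_eq_self_iff.1 (shift_injective ((k : ℤ) • e) ?_) u)
        rw [shift_shift, ← add_smul, add_sub_cancel, heq]
      · exact ⟨0, fun k _ hk => hz ⟨k, hk⟩⟩)
  exact hz.2 (h.2 z (Preceq.mem hcl hinv h.1 hz.1) hz.1)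

theorem Level0.exists_biPeriodic [DiscreteTopology A] [Finite A] {X : Set (Config A)}
    (hcl : IsClosed X) (hinv : ∀ v, ∀ x ∈ X, CountableSubshift.shift v x ∈ X)
    (hcount : X.Countable) {y : Config A} (h : Level0 X y) : ∃ M, BiPeriodic M y := by
  obtain ⟨a, ha, hya⟩ := h.exists_period hcl hinv hcount (1, 0)
  obtain ⟨b, hb, hyb⟩ := h.exists_period hcl hinv hcount (0, 1)
  refine ⟨a * b, mul_pos ha hb, fun u => ?_, fun u => ?_⟩
  · simpa [mul_comm] using apply_add_zsmul hya b u
  · simpa [mul_comm] using apply_add_zsmul hyb a u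

end DoublyPeriodic

section Gluing

theorem false_of_injective_of_countable {α ι : Type*} [Infinite ι] {X : Set α}
    (hX : X.Countable) (f : (ι → Bool) → α) (hf : Function.Injective f) (hfX : ∀ S, f S ∈ X) :
    False := by
  have : Countable X := hX.to_subtype
  have : Countable (ι → Bool) :=
    Function.Injective.countable (f := fun S => (⟨f S, hfX S⟩ : X))
      fun S T h => hf (congrArg Subtype.val h)
  have hle : Cardinal.mk (ι → Bool) ≤ Cardinal.aleph0 := Cardinal.mk_le_aleph0
  refine absurd ((Cardinal.aleph0_le_mk ι).trans_lt (Cardinal.cantor (Cardinal.mk ι))) ?_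
  rw [not_lt]
  simpa only [Cardinal.mk_arrow, Cardinal.mk_bool, Cardinal.lift_ofNat, Cardinal.lift_uzero]
    using hle

/-- In a countable SFT, a finite modification of a doubly periodic configuration is trivial. -/
theorem eq_of_eq_off_inBox {A : Type*} {X : Set (Config A)} (hX : IsSFT X)
    (hcount : X.Countable) {p y : Config A} (hp : p ∈ X) (hy : y ∈ X) {L : ℤ}
    (hper : BiPeriodic L p) (K : ℕ) (h : ∀ u, ¬ InBox K u → y u = p u) : y = p := by
  by_contra hne
  obtain ⟨u₀, hu₀⟩ := Function.ne_iff.1 hne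
  have hu₀K : InBox K u₀ := by
    by_contra hcon
    exact hu₀ (h u₀ hcon)
  obtain ⟨r, hr⟩ := hX.exists_radius
  obtain ⟨R, hR⟩ : ∃ R : ℤ, R = K + (r + r) := ⟨_, rfl⟩
  obtain ⟨N, hN⟩ : ∃ N : ℤ, N = L * (2 * R + 1) := ⟨_, rfl⟩
  have hL := hper.1
  have hNR : 2 * R + 1 ≤ N := by nlinarith
  have hblock : ∀ a c : ℤ, -R ≤ a - N * c → a - N * c ≤ R → (a + R) / N = c := by
    intro a c h₁ h₂
    have hNpos : 0 < N := by omega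
    refine le_antisymm (Int.lt_add_one_iff.1 (Int.ediv_lt_of_lt_mul hNpos ?_))
      (Int.le_ediv_of_mul_le hNpos ?_) <;> nlinarith
  obtain ⟨j, hj⟩ : ∃ j : ℤ × ℤ → ℤ × ℤ, ∀ u c, InBox R (u - (N * c.1, N * c.2)) → j u = c :=
    ⟨fun u => ((u.1 + R) / N, (u.2 + R) / N), fun u c hu =>
      Prod.ext (hblock _ _ hu.1.1 hu.1.2) (hblock _ _ hu.2.1 hu.2.2)⟩
  have hpN : ∀ (u c : ℤ × ℤ), p (u - (N * c.1, N * c.2)) = p u := by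
    intro u c
    rw [← hper.apply_add (-(2 * R + 1) * c.1) (-(2 * R + 1) * c.2) u, hN]
    congr 1
    ext
    · simp only [Prod.fst_sub, Prod.fst_add]; ring
    · simp only [Prod.snd_sub, Prod.snd_add]; ring
  let z : (ℤ × ℤ → Bool) → Config A := fun S u =>
    if S (j u) then y (u - (N * (j u).1, N * (j u).2)) else p u
  refine false_of_injective_of_countable hcount z (fun S T hST => funext fun c => ?_)
    fun S => hr _ fun u => ?_
  · have hc : j (u₀ + (N * c.1, N * c.2)) = c :=
      hj _ _ (by rw [add_sub_cancel_right]; exact hu₀K.mono (by omega))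
    have hpc := hpN (u₀ + (N * c.1, N * c.2)) c
    have hzc := congrFun hST (u₀ + (N * c.1, N * c.2))
    simp only [z, hc] at hzc
    rw [add_sub_cancel_right] at hzc hpc
    rw [← hpc] at hzc
    cases hS : S c <;> cases hT : T c <;> simp [hS, hT, hu₀, Ne.symm hu₀] at hzc ⊢
  · by_cases hnear : ∃ d c : ℤ × ℤ, InBox r d ∧ InBox K (u + d - (N * c.1, N * c.2))
    · obtain ⟨d, c, hd, hdc⟩ := hnear
      have hjc : ∀ d', InBox r d' → j (u + d') = c := fun d' hd' => hj _ _ (by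
        have := hdc.add (hd'.add hd.neg)
        rw [hR]
        convert this using 1
        abel)
      by_cases hS : S c
      · refine ⟨shift (-(N * c.1, N * c.2)) y, hX.shift_mem _ _ hy, fun d' hd' => ?_⟩
        simp only [z, hjc d' hd', hS, if_true, shift, sub_eq_add_neg]
      · refine ⟨p, hp, fun d' hd' => ?_⟩
        simp only [z, hjc d' hd', hS]
        simp
    · push Not at hnear
      refine ⟨p, hp, fun d hd => ?_⟩
      simp only [z]
      split_ifs
      · rw [h _ (hnear d _ hd), hpN]
      · rfl

/-- Rearranging the layers `f u / f w = i` of `x` along a path `σ` all of whose jumps join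
positions where `x` looks the same gives an element of the SFT. -/
theorem splice_mem {A : Type*} {X : Set (Config A)} {r : ℕ}
    (hr : ∀ z : Config A, (∀ u, ∃ x ∈ X, ∀ d, InBox r d → z (u + d) = x (u + d)) → z ∈ X)
    (hinv : ∀ v, ∀ x ∈ X, shift v x ∈ X) {x : Config A} (hx : x ∈ X)
    {f : ℤ × ℤ →+ ℤ} {w : ℤ × ℤ} {R : ℤ} (hR : ∀ d, InBox r d → |f d| ≤ R)
    (hw : 2 * R < f w)
    (σ : ℤ → ℤ)
    (hσ : ∀ i t, |f t| ≤ 2 * R → x (t + (σ i + 1) • w) = x (t + σ (i + 1) • w)) :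
    (fun u => x (u + (σ (f u / f w) - f u / f w) • w)) ∈ X := by
  refine hr _ fun u => ?_
  have hR0 : 0 ≤ R := (abs_nonneg _).trans (hR 0 (by simp [InBox]))
  have hw0 : 0 < f w := by omega
  obtain ⟨i, hi⟩ : ∃ i, i = (f u - R) / f w := ⟨_, rfl⟩
  have h₁ : f w * i ≤ f u - R := by rw [hi]; exact Int.mul_ediv_self_le hw0.ne'
  have h₂ : f u - R < f w * i + f w := by rw [hi]; exact Int.lt_mul_ediv_self_add hw0
  refine ⟨shift ((σ i - i) • w) x, hinv _ _ hx, fun d hd => ?_⟩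
  have hd := abs_le.1 (hR d hd)
  have hfd : f (u + d) = f u + f d := map_add f u d
  simp only [shift]
  rcases lt_or_ge (f (u + d)) (f w * i + f w) with hlt | hge
  · have : f (u + d) / f w = i :=
      le_antisymm (Int.lt_add_one_iff.1 (Int.ediv_lt_of_lt_mul hw0 (by linarith)))
        (Int.le_ediv_of_mul_le hw0 (by linarith))
    rw [this]
  · have : f (u + d) / f w = i + 1 :=
      le_antisymm (Int.lt_add_one_iff.1 (Int.ediv_lt_of_lt_mul hw0 (by linarith)))
        (Int.le_ediv_of_mul_le hw0 (by linarith))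
    rw [this]
    have hft : f (u + d - (i + 1) • w) = f (u + d) - (f w * i + f w) := by
      rw [map_sub, map_zsmul, smul_eq_mul]; ring
    have := hσ i (u + d - (i + 1) • w) (abs_le.2 ⟨by linarith, by linarith⟩)
    convert this.symm using 2
    · rw [sub_smul]; abel
    · simp only [sub_smul, add_smul]; abel

/-- If `x` looks the same at three positions `k₀ < k₁ < k₂` then, in a countable SFT, the two
loops between them commute. -/
theorem eq_of_three_returns {A : Type*} {X : Set (Config A)} {r : ℕ}
    (hr : ∀ z : Config A, (∀ u, ∃ x ∈ X, ∀ d, InBox r d → z (u + d) = x (u + d)) → z ∈ X)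
    (hinv : ∀ v, ∀ x ∈ X, shift v x ∈ X) {x : Config A} (hx : x ∈ X)
    {f : ℤ × ℤ →+ ℤ} {w : ℤ × ℤ} {R : ℤ} (hR : ∀ d, InBox r d → |f d| ≤ R)
    (hw : 2 * R < f w)
    (hcount : X.Countable) {k₀ k₁ k₂ : ℤ} (h01 : k₀ < k₁) (h12 : k₁ < k₂)
    (hk : ∀ k ∈ ({k₀, k₁, k₂} : Set ℤ), ∀ t, |f t| ≤ 2 * R → x (t + k • w) = x (t + k₀ • w))
    {u : ℤ × ℤ} (hu : f w * k₀ ≤ f u) (hu' : f u < f w * (k₀ + (k₂ - k₁))) :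
    x (u + (k₁ - k₀) • w) = x u := by
  by_contra hne
  have hR0 : 0 ≤ R := (abs_nonneg _).trans (hR 0 (by simp [InBox]))
  have hw0 : 0 < f w := by omega
  obtain ⟨L, hL⟩ : ∃ L, L = k₂ - k₀ := ⟨_, rfl⟩
  let σ : (ℤ → Bool) → ℤ → ℤ := fun S i =>
    if S (i / L) then k₀ + i % L
    else if i % L < k₂ - k₁ then k₁ + i % L else k₀ + i % L - (k₂ - k₁)
  refine false_of_injective_of_countable hcount
    (fun (S : ℤ → Bool) u => x (u + (σ S (f u / f w) - f u / f w) • w)) ?_ fun S => ?_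
  · intro S T hST
    funext j
    obtain ⟨q, hq⟩ : ∃ q, q = f u / f w := ⟨_, rfl⟩
    have hq₀ : k₀ ≤ q := by rw [hq]; exact Int.le_ediv_of_mul_le hw0 (by linarith)
    have hq₁ : q < k₀ + (k₂ - k₁) := by rw [hq]; exact Int.ediv_lt_of_lt_mul hw0 (by linarith)
    have hlayer : f (u + (j * L - k₀) • w) / f w = (q - k₀) + L * j := by
      rw [map_add, map_zsmul, smul_eq_mul, Int.add_mul_ediv_right _ _ hw0.ne', ← hq]
      ring
    have hdiv : ((q - k₀) + L * j) / L = j := by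
      rw [Int.add_mul_ediv_left _ _ (by omega), Int.ediv_eq_zero_of_lt (by omega) (by omega),
        zero_add]
    have hmod : ((q - k₀) + L * j) % L = q - k₀ := by
      rw [Int.add_mul_emod_self_left, Int.emod_eq_of_lt (by omega) (by omega)]
    have hval : ∀ S, x (u + (j * L - k₀) • w + (σ S ((q - k₀) + L * j) - ((q - k₀) + L * j)) • w)
        = if S j then x u else x (u + (k₁ - k₀) • w) := by
      intro S
      simp only [σ, hdiv, hmod]
      rw [add_assoc, ← add_smul]
      split_ifs with h₁ h₂
      · congr 1
        rw [add_eq_left]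
        convert zero_smul ℤ w using 2
        ring
      · congr 3
        ring
      · omega
    have h := congrFun hST (u + (j * L - k₀) • w)
    simp only [hlayer] at h
    rw [hval, hval] at h
    cases hS : S j <;> cases hT : T j <;> simp only [hS, hT, if_true] at h ⊢
    · exact absurd h hne
    · exact absurd h.symm hne
  · refine splice_mem hr hinv hx hR hw (σ S) fun i t ht => ?_
    have hcases : σ S i + 1 = σ S (i + 1) ∨
        ((σ S i + 1 = k₁ ∨ σ S i + 1 = k₂) ∧ (σ S (i + 1) = k₀ ∨ σ S (i + 1) = k₁)) := by
      have hLpos : 0 < L := by omega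
      have h₁ := Int.emod_nonneg i hLpos.ne'
      have h₂ := Int.emod_lt_of_pos i hLpos
      have h₃ := Int.emod_add_mul_ediv i L
      by_cases hlast : i % L + 1 = L
      · have hmod : (i + 1) % L = 0 := by
          rw [show i + 1 = L * (i / L + 1) by linarith, Int.mul_emod_right]
        simp only [σ, hmod]
        split_ifs <;> omega
      · have hi : i + 1 = (i % L + 1) + L * (i / L) := by linarith
        have hmod : (i + 1) % L = i % L + 1 := by
          rw [hi, Int.add_mul_emod_self_left, Int.emod_eq_of_lt (by omega) (by omega)]
        have hdiv : (i + 1) / L = i / L := by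
          conv_lhs => rw [hi]
          rw [Int.add_mul_ediv_left _ _ hLpos.ne', Int.ediv_eq_zero_of_lt (by omega) (by omega),
            zero_add]
        simp only [σ, hmod, hdiv]
        split_ifs <;> omega
    rcases hcases with h | ⟨h₁, h₂⟩
    · rw [h]
    · exact (hk _ (by rcases h₁ with h | h <;> simp [h]) t ht).trans
        (hk _ (by rcases h₂ with h | h <;> simp [h]) t ht).symm

end Gluing

section OnePeriod

/-- The determinant of `v` and `u`, as an additive function of `u`. -/
def cross (v : ℤ × ℤ) : ℤ × ℤ →+ ℤ where
  toFun u := v.1 * u.2 - v.2 * u.1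
  map_zero' := by simp
  map_add' a b := by simp only [Prod.fst_add, Prod.snd_add]; ring

theorem cross_apply (v u : ℤ × ℤ) : cross v u = v.1 * u.2 - v.2 * u.1 := rfl

/-- The vector `v` rotated by a right angle. -/
def perp (v : ℤ × ℤ) : ℤ × ℤ := (-v.2, v.1)

theorem dot_self_pos {v : ℤ × ℤ} (hv : v ≠ 0) : 0 < dot v v := by
  have : v.1 ≠ 0 ∨ v.2 ≠ 0 := by
    by_contra! h
    exact hv (Prod.ext h.1 h.2)
  unfold dot
  rcases this with h | h
  · have := mul_self_pos.2 h
    nlinarith [mul_self_nonneg v.2]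
  · have := mul_self_pos.2 h
    nlinarith [mul_self_nonneg v.1]

theorem cross_perp (v : ℤ × ℤ) : cross v (perp v) = dot v v := by
  simp only [cross_apply, perp, dot]; ring

theorem abs_cross_le {v d : ℤ × ℤ} {n : ℤ} (hd : InBox n d) :
    |cross v d| ≤ n * (|v.1| + |v.2|) := by
  have h₁ : |d.1| ≤ n := abs_le.2 hd.1
  have h₂ : |d.2| ≤ n := abs_le.2 hd.2
  calc |cross v d| ≤ |v.1 * d.2| + |v.2 * d.1| := abs_sub _ _
    _ = |v.1| * |d.2| + |v.2| * |d.1| := by rw [abs_mul, abs_mul]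
    _ ≤ |v.1| * n + |v.2| * n := by gcongr
    _ = n * (|v.1| + |v.2|) := by ring

/-- Modulo `v`, a strip parallel to `v` is contained in a box. -/
theorem exists_sub_zsmul_inBox {v : ℤ × ℤ} (hv : v ≠ 0) {C : ℤ} {u : ℤ × ℤ}
    (hu : |cross v u| ≤ C) : ∃ k : ℤ, InBox (dot v v + C) (u - k • v) := by
  have hm := dot_self_pos hv
  refine ⟨dot v u / dot v v, ?_⟩
  set k := dot v u / dot v v with hk
  have hd₀ : 0 ≤ dot v u - dot v v * k := by
    have := Int.mul_ediv_self_le (x := dot v u) hm.ne'; linarith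
  have hd₁ : dot v u - dot v v * k ≤ dot v v := by
    have := Int.lt_mul_ediv_self_add (x := dot v u) hm; linarith
  have hd : |dot v u - dot v v * k| ≤ dot v v := abs_le.2 ⟨by linarith, hd₁⟩
  have hsq : ∀ a : ℤ, |a| ≤ a * a := fun a => by
    rw [Int.abs_eq_natAbs, ← Int.natAbs_mul_self]
    exact_mod_cast Nat.le_mul_self _
  have hv₁ : |v.1| ≤ dot v v :=
    (hsq v.1).trans (le_add_of_nonneg_right (mul_self_nonneg v.2))
  have hv₂ : |v.2| ≤ dot v v :=
    (hsq v.2).trans (le_add_of_nonneg_left (mul_self_nonneg v.1))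
  have hC : 0 ≤ C := (abs_nonneg _).trans hu
  have h₁ : dot v v * (u - k • v).1 = v.1 * (dot v u - dot v v * k) - v.2 * cross v u := by
    simp only [dot, cross_apply, Prod.fst_sub, Prod.smul_fst, smul_eq_mul]; ring
  have h₂ : dot v v * (u - k • v).2 = v.2 * (dot v u - dot v v * k) + v.1 * cross v u := by
    simp only [dot, cross_apply, Prod.snd_sub, Prod.smul_snd, smul_eq_mul]; ring
  have key : ∀ a b : ℤ, |a| ≤ dot v v → |b| ≤ dot v v →
      |a * (dot v u - dot v v * k)| + |b * cross v u| ≤ dot v v * (dot v v + C) := by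
    intro a b ha hb
    rw [abs_mul, abs_mul, mul_add]
    gcongr
  refine ⟨abs_le.1 ?_, abs_le.1 ?_⟩
  · refine le_of_mul_le_mul_left ?_ hm
    rw [← abs_of_pos hm, ← abs_mul, h₁, abs_of_pos hm]
    exact (abs_sub _ _).trans (key _ _ hv₁ hv₂)
  · refine le_of_mul_le_mul_left ?_ hm
    rw [← abs_of_pos hm, ← abs_mul, h₂, abs_of_pos hm]
    exact (abs_add_le _ _).trans (key _ _ hv₂ hv₁)

variable {X : Set (Config A)}

/-- An element with period `v` of a countable SFT is eventually periodic away from the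
line spanned by `v`, on the side of `perp v`. -/
theorem exists_eventual_period {A : Type*} [Finite A] {X : Set (Config A)} (hX : IsSFT X)
    (hcount : X.Countable) {x : Config A} (hx : x ∈ X) {v : ℤ × ℤ} (hv : v ≠ 0)
    (hper : ∀ u, x (u + v) = x u) :
    ∃ N : ℤ, 0 < N ∧ ∃ K : ℤ, ∀ u, K ≤ cross v u → x (u + N • perp v) = x u := by
  obtain ⟨r, hr⟩ := hX.exists_radius
  obtain ⟨R, hR⟩ : ∃ R : ℤ, R = r * (|v.1| + |v.2|) := ⟨_, rfl⟩
  have hRbound : ∀ d, InBox r d → |cross v d| ≤ R := fun d hd => hR ▸ abs_cross_le hd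
  have hR0 : 0 ≤ R := (abs_nonneg _).trans (hRbound 0 (by simp [InBox]))
  have hm := dot_self_pos hv
  obtain ⟨w, hw⟩ : ∃ w, w = (2 * R + 1) • perp v := ⟨_, rfl⟩
  have hcw : 2 * R < cross v w := by
    rw [hw, map_zsmul, cross_perp, smul_eq_mul]; nlinarith
  have hfin : Finite {u // InBox (dot v v + 2 * R) u} := (finite_inBox _).to_subtype
  let F : ℕ → {u // InBox (dot v v + 2 * R) u} → A := fun k u => x (u.1 + (k : ℤ) • w)
  obtain ⟨g, hg⟩ := Finite.exists_infinite_fiber F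
  rw [Set.infinite_coe_iff] at hg
  have hreturn : ∀ k l : ℕ, F k = g → F l = g → ∀ t, |cross v t| ≤ 2 * R →
      x (t + (k : ℤ) • w) = x (t + (l : ℤ) • w) := by
    intro k l hk hl t ht
    obtain ⟨q, hq⟩ := exists_sub_zsmul_inBox hv ht
    have hmove : ∀ k : ℤ, x (t + k • w) = x (t - q • v + k • w) := fun k => by
      rw [← apply_add_zsmul hper q (t - q • v + k • w)]
      congr 1
      abel
    have := congrFun (hk.trans hl.symm) ⟨_, hq⟩
    rw [hmove, hmove]
    exact this
  obtain ⟨k₀, hk₀⟩ := hg.nonempty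
  obtain ⟨k₁, hk₁, h01⟩ := hg.exists_gt k₀
  refine ⟨((k₁ : ℤ) - k₀) * (2 * R + 1), mul_pos (by omega) (by omega), cross v w * k₀,
    fun u hu => ?_⟩
  obtain ⟨k₂, hk₂, h12⟩ := hg.exists_gt (k₁ + (cross v u).toNat)
  rw [mul_smul, ← hw]
  refine eq_of_three_returns hr hX.shift_mem hx hRbound hcw hcount (k₀ := k₀) (k₁ := k₁)
    (k₂ := k₂) (by omega) (by omega) (fun k hk => ?_) hu ?_
  · rcases hk with rfl | rfl | rfl
    · exact fun _ _ => rfl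
    · exact hreturn _ _ hk₁ hk₀
    · exact hreturn _ _ hk₂ hk₀
  · have h₁ : cross v u < k₂ - k₁ := by omega
    have h₂ : (1 : ℤ) ≤ cross v w := by omega
    nlinarith

/-- An element with a period `v` of a countable SFT is eventually periodic on both sides of the
line spanned by `v`. -/
theorem exists_eventual_period_abs {A : Type*} [Finite A] {X : Set (Config A)} (hX : IsSFT X)
    (hcount : X.Countable) {x : Config A} (hx : x ∈ X) {v : ℤ × ℤ} (hv : v ≠ 0)
    (hper : ∀ u, x (u + v) = x u) :
    ∃ N : ℤ, 0 < N ∧ ∃ K : ℤ, ∀ u, K ≤ |cross v u| → x (u + N • perp v) = x u := by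
  obtain ⟨N₁, hN₁, K₁, h₁⟩ := exists_eventual_period hX hcount hx hv hper
  obtain ⟨N₂, hN₂, K₂, h₂⟩ := exists_eventual_period hX hcount hx (v := -v) (neg_ne_zero.2 hv)
    fun u => by rw [← hper, neg_add_cancel_right]
  have hm := dot_self_pos hv
  have hcross : ∀ u, cross (-v) u = -cross v u := fun u => by
    simp only [cross_apply, Prod.fst_neg, Prod.snd_neg]; ring
  have hperp : perp (-v) = -perp v := by simp [perp]
  have h₁' : ∀ k : ℕ, ∀ u, K₁ ≤ cross v u → x (u + (k * N₁) • perp v) = x u := by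
    intro k
    induction k with
    | zero => simp
    | succ k ih =>
      intro u hu
      have : K₁ ≤ cross v (u + (k * N₁) • perp v) := by
        rw [map_add, map_zsmul, cross_perp, smul_eq_mul]
        have : 0 ≤ (k * N₁) * dot v v := by positivity
        linarith
      rw [← ih u hu, ← h₁ _ this, add_assoc, ← add_smul]
      push_cast
      ring_nf
  have h₂' : ∀ k : ℕ, ∀ u, K₂ ≤ -cross v u → x (u - (k * N₂) • perp v) = x u := by
    intro k
    induction k with
    | zero => simp
    | succ k ih =>
      intro u hu
      have : K₂ ≤ cross (-v) (u - (k * N₂) • perp v) := by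
        rw [hcross, map_sub, map_zsmul, cross_perp, smul_eq_mul]
        have : 0 ≤ (k * N₂) * dot v v := by positivity
        linarith
      rw [← ih u hu, ← h₂ _ this, hperp, smul_neg, ← sub_eq_add_neg, sub_sub, ← add_smul]
      push_cast
      ring_nf
  refine ⟨N₁ * N₂, mul_pos hN₁ hN₂, |K₁| + |K₂| + N₁ * N₂ * dot v v, fun u hu => ?_⟩
  have hpos : 0 ≤ N₁ * N₂ * dot v v := by positivity
  have hK₁ := le_abs_self K₁
  have hK₂ := le_abs_self K₂
  have hK₁' := abs_nonneg K₁
  have hK₂' := abs_nonneg K₂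
  rcases le_abs'.1 hu with h | h
  · have := h₂' N₁.toNat (u + (N₁ * N₂) • perp v) (by
      rw [map_add, map_zsmul, cross_perp, smul_eq_mul]; linarith)
    rw [Int.toNat_of_nonneg hN₁.le, add_sub_cancel_right] at this
    exact this.symm
  · have := h₁' N₂.toNat u (by linarith)
    rwa [Int.toNat_of_nonneg hN₂.le, mul_comm] at this

theorem biPeriodic_of_periods {A : Type*} {y : Config A} {v : ℤ × ℤ} (hv : v ≠ 0) {N : ℤ}
    (hN : 0 < N) (h₁ : ∀ u, y (u + v) = y u) (h₂ : ∀ u, y (u + N • perp v) = y u) :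
    BiPeriodic (N * dot v v) y := by
  refine ⟨mul_pos hN (dot_self_pos hv), fun u => ?_, fun u => ?_⟩
  · rw [← apply_add_zsmul h₁ (N * v.1) u, ← apply_add_zsmul h₂ (-v.2) (u + (N * v.1) • v)]
    congr 1
    ext <;> simp [perp, dot] <;> ring
  · rw [← apply_add_zsmul h₁ (N * v.2) u, ← apply_add_zsmul h₂ v.1 (u + (N * v.2) • v)]
    congr 1
    ext <;> simp [perp, dot] <;> ring

/-- In a countable SFT, whatever lies strictly below a configuration with a period is doubly
periodic. -/
theorem exists_biPeriodic_of_prec [DiscreteTopology A] [Finite A] (hX : IsSFT X)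
    (hcount : X.Countable) {x y : Config A} (hx : x ∈ X) {v : ℤ × ℤ} (hv : v ≠ 0)
    (hper : ∀ u, x (u + v) = x u) (hyx : Prec y x) : ∃ M, BiPeriodic M y := by
  obtain ⟨N, hN, K, hK⟩ := exists_eventual_period_abs hX hcount hx hv hper
  refine ⟨_, biPeriodic_of_periods hv hN (fun u => ?_) fun u => ?_⟩
  · obtain ⟨n, hn⟩ := exists_inBox_of_finite (Set.toFinite {u, u + v})
    obtain ⟨c, hc⟩ := preceq_iff.1 hyx.1 n
    rw [← hc _ (hn u (by simp)), ← hc _ (hn (u + v) (by simp)), add_right_comm, hper]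
  · obtain ⟨C, hC⟩ : ∃ C : ℤ, C = K + |cross v u| := ⟨_, rfl⟩
    have hfin : ((fun c => shift c x) '' {c | |cross v c| ≤ C}).Finite := by
      refine ((finite_inBox (dot v v + C)).image fun c => shift c x).subset ?_
      rintro _ ⟨c, hc, rfl⟩
      obtain ⟨k, hk⟩ := exists_sub_zsmul_inBox hv hc
      refine ⟨_, hk, funext fun t => ?_⟩
      simp only [shift]
      rw [← apply_add_zsmul hper k]
      congr 1
      abel
    have hsub : orbit x ⊆ (fun c => shift c x) '' {c | |cross v c| ≤ C} ∪
        (fun c => shift c x) '' {c | C < |cross v c|} := by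
      rintro _ ⟨c, rfl⟩
      rcases le_or_gt |cross v c| C with h | h
      · exact Or.inl ⟨c, h, rfl⟩
      · exact Or.inr ⟨c, h, rfl⟩
    have hmem := closure_mono hsub hyx.1
    rw [closure_union, hfin.isClosed.closure_eq] at hmem
    rcases hmem with ⟨c, -, rfl⟩ | hmem
    · exact absurd (preceq_of_mem_orbit ⟨c, rfl⟩) hyx.2
    · obtain ⟨n, hn⟩ := exists_inBox_of_finite (Set.toFinite {u, u + N • perp v})
      obtain ⟨_, ⟨c, hc, rfl⟩, h⟩ := mem_closure_iff_inBox.1 hmem n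
      rw [← h _ (hn u (by simp)), ← h _ (hn (u + N • perp v) (by simp))]
      simp only [shift]
      rw [add_right_comm]
      refine hK _ ?_
      have h₁ : C < |cross v c| := hc
      have h₂ : |cross v c| ≤ |cross v u + cross v c| + |cross v u| := by
        have := abs_sub (cross v u + cross v c) (cross v u)
        rwa [add_sub_cancel_left] at this
      rw [map_add]
      linarith

/-- In a countable SFT, a configuration with a period is at level 0 or at level 1. -/
theorem level0_or_level1_of_period [DiscreteTopology A] [Finite A] (hX : IsSFT X)
    (hcount : X.Countable) {x : Config A} (hx : x ∈ X) {v : ℤ × ℤ} (hv : v ≠ 0)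
    (hper : shift v x = x) : Level0 X x ∨ Level1 X x := by
  by_cases h0 : Level0 X x
  · exact Or.inl h0
  · refine Or.inr ⟨hx, h0, fun y hy hyx => ?_⟩
    obtain ⟨M, hM⟩ := exists_biPeriodic_of_prec hX hcount hx hv (shift_eq_self_iff.1 hper) hyx
    exact hM.level0 hy

end OnePeriod

section NoPeriod

theorem forall_mem_of_steps {S : Set ℤ} [S.OrdConnected] {Q : ℤ → Prop}
    (h : ∀ t ∈ S, Q t → Q (t + 1) ∧ Q (t - 1)) {a b : ℤ} (ha : a ∈ S) (hb : b ∈ S) (hQ : Q a) :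
    Q b := by
  rcases le_total a b with hab | hba
  · have : ∀ t, a ≤ t → t ≤ b → Q t := fun t hat =>
      Int.leInduction (m := a) (motive := fun t _ => t ≤ b → Q t) (fun _ => hQ)
        (fun t hat ih htb =>
          (h t (Set.OrdConnected.out ‹_› ha hb ⟨hat, by omega⟩) (ih (by omega))).1) t hat
    exact this b hab le_rfl
  · have : ∀ t, t ≤ a → b ≤ t → Q t := fun t hta =>
      Int.leInductionDown (m := a) (motive := fun t _ => b ≤ t → Q t) (fun _ => hQ)
        (fun t hta ih hbt =>
          (h t (Set.OrdConnected.out ‹_› hb ha ⟨by omega, hta⟩) (ih (by omega))).2) t hta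
    exact this b hba le_rfl

/-- The complement of a box in the square lattice is connected. -/
theorem forall_not_inBox_of_steps {P : ℤ × ℤ → Prop} {K : ℤ}
    (h : ∀ a b : ℤ, ¬ InBox K (a, b) → P (a, b) →
      (P (a + 1, b) ∧ P (a - 1, b)) ∧ (P (a, b + 1) ∧ P (a, b - 1)))
    {c₀ : ℤ × ℤ} (hc₀ : ¬ InBox K c₀) (hP : P c₀) {c : ℤ × ℤ} (hc : ¬ InBox K c) : P c := by
  have vertical : ∀ (S : Set ℤ) [S.OrdConnected], (∀ a ∈ S, ∀ b, ¬ InBox K (a, b)) →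
      ∀ c c' : ℤ × ℤ, c.1 ∈ S → c'.1 ∈ S → P c → P c' := by
    intro S _ hS c c' hcS hcS' hPc
    have h₁ : P (c.1, c'.2) := forall_mem_of_steps (S := Set.univ) (Q := fun t => P (c.1, t))
      (fun t _ ht => (h _ _ (hS _ hcS t) ht).2) (Set.mem_univ c.2) (Set.mem_univ _) hPc
    exact forall_mem_of_steps (Q := fun t => P (t, c'.2))
      (fun t htS ht => (h _ _ (hS t htS _) ht).1) hcS hcS' h₁
  have horizontal : ∀ (S : Set ℤ) [S.OrdConnected], (∀ b ∈ S, ∀ a, ¬ InBox K (a, b)) →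
      ∀ c c' : ℤ × ℤ, c.2 ∈ S → c'.2 ∈ S → P c → P c' := by
    intro S _ hS c c' hcS hcS' hPc
    have h₁ : P (c'.1, c.2) := forall_mem_of_steps (S := Set.univ) (Q := fun t => P (t, c.2))
      (fun t _ ht => (h _ _ (hS _ hcS t) ht).1) (Set.mem_univ c.1) (Set.mem_univ _) hPc
    exact forall_mem_of_steps (Q := fun t => P (c'.1, t))
      (fun t htS ht => (h _ _ (hS t htS _) ht).2) hcS hcS' h₁
  have right := vertical (Set.Ioi K) fun a ha b hab => absurd hab.1.2 (not_le.2 ha)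
  have left := vertical (Set.Iio (-K)) fun a ha b hab => absurd hab.1.1 (not_le.2 ha)
  have top := horizontal (Set.Ioi K) fun b hb a hab => absurd hab.2.2 (not_le.2 hb)
  have bottom := horizontal (Set.Iio (-K)) fun b hb a hab => absurd hab.2.1 (not_le.2 hb)
  simp only [Set.mem_Ioi, Set.mem_Iio] at right left top bottom
  have corner : ∀ c : ℤ × ℤ, ¬ InBox K c → (P c ↔ P (K + 1, K + 1)) := by
    intro c hc
    have hcases : K < c.1 ∨ K < c.2 ∨ c.1 < -K ∨ c.2 < -K := by
      unfold InBox at hc; omega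
    have hK : K < K + 1 := by omega
    have hK' : -K - 1 < -K := by omega
    rcases hcases with hc | hc | hc | hc
    · exact ⟨right _ _ hc hK, right _ _ hK hc⟩
    · exact ⟨top _ _ hc hK, top _ _ hK hc⟩
    · exact ⟨fun hP => top (-K - 1, K + 1) _ hK hK (left _ _ hc hK' hP),
        fun hP => left (-K - 1, K + 1) _ hK' hc (top _ _ hK hK hP)⟩
    · exact ⟨fun hP => right (K + 1, -K - 1) _ hK hK (bottom _ _ hc hK' hP),
        fun hP => bottom (K + 1, -K - 1) _ hK' hc (right _ _ hK hK hP)⟩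
  exact (corner c hc).2 ((corner c₀ hc₀).1 hP)

/-- The points where `y` and `p` differ at the corner of a square of size `R` on whose diagonal
they agree. -/
def cornerDefects {A : Type*} (y p : Config A) (R : ℕ) : Set (ℤ × ℤ) :=
  {u | y u ≠ p u ∧ ∃ s t : ℤ, (s = 1 ∨ s = -1) ∧ (t = 1 ∨ t = -1) ∧
    ∀ q : ℤ, 1 ≤ q → q ≤ R → y (u + (s * q, t * q)) = p (u + (s * q, t * q))}

/-- If `y` agrees with `p` on arbitrarily large squares and there are finitely many corner
defects, then there are finitely many differences. -/
theorem exists_eq_off_inBox {A : Type*} {y p : Config A} {R : ℕ}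
    (hfin : (cornerDefects y p R).Finite)
    (hball : ∀ n : ℕ, ∃ u, ∀ d, InBox n d → y (u + d) = p (u + d)) :
    ∃ K : ℕ, ∀ u, ¬ InBox K u → y u = p u := by
  obtain ⟨B, hB⟩ := exists_inBox_of_finite hfin
  let P : ℤ × ℤ → Prop := fun c => ∀ d, InBox R d → y (c + d) = p (c + d)
  have hboundary : ∀ (c e : ℤ × ℤ), InBox 1 e → (e.1 = 0 ∨ e.2 = 0) →
      ¬ InBox ((B + R + 1 : ℕ) : ℤ) c → P c → P (c + e) := by
    intro c e he he0 hc hP d hd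
    by_contra hne
    have hagree : ∀ t : ℤ × ℤ, InBox R (e + d + t) →
        y (c + e + d + t) = p (c + e + d + t) := fun t ht => by
      have := hP _ ht
      rwa [← add_assoc, ← add_assoc] at this
    have hout : ¬ InBox R (e + d) := fun h => by
      have := hagree 0 (by simpa using h)
      simp only [add_zero] at this
      exact hne this
    have hmem : c + e + d ∈ cornerDefects y p R := by
      refine ⟨hne, if 0 < e.1 + d.1 then -1 else 1, if 0 < e.2 + d.2 then -1 else 1,
        ?_, ?_, fun q hq hqR => hagree _ ?_⟩
      · split_ifs <;> simp
      · split_ifs <;> simp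
      · simp only [InBox, Prod.fst_add, Prod.snd_add] at *
        split_ifs <;> omega
    have := hB _ hmem
    simp only [InBox, Prod.fst_add, Prod.snd_add] at *
    omega
  refine ⟨B + R + 1, fun u hu => ?_⟩
  obtain ⟨c, hc⟩ := hball (R + (2 * (B + R + 1) + 1))
  have hstart : ∃ c₀, ¬ InBox ((B + R + 1 : ℕ) : ℤ) c₀ ∧ P c₀ := by
    have hP : ∀ t, InBox ((2 * (B + R + 1) + 1 : ℕ) : ℤ) t → P (c + t) := fun t ht d hd => by
      rw [add_assoc, add_comm t d]
      exact hc _ (by exact_mod_cast hd.add ht)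
    by_cases h : InBox ((B + R + 1 : ℕ) : ℤ) c
    · refine ⟨c + ((2 * (B + R + 1) + 1 : ℤ), (0 : ℤ)), ?_, hP _ ?_⟩
      · simp only [InBox, Prod.fst_add] at *; omega
      · simp only [InBox]; omega
    · exact ⟨c, h, by simpa using hP 0 (by simp only [InBox, Prod.fst_zero, Prod.snd_zero]; omega)⟩
  obtain ⟨c₀, hc₀, hPc₀⟩ := hstart
  have := forall_not_inBox_of_steps (P := P) (fun a b hab hP => ⟨⟨?_, ?_⟩, ?_, ?_⟩) hc₀ hPc₀ hu
    0 (by simp [InBox])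
  · simpa using this
  · simpa using hboundary (a, b) (1, 0) (by simp [InBox]) (by simp) hab hP
  · simpa [sub_eq_add_neg] using hboundary (a, b) (-1, 0) (by simp [InBox]) (by simp) hab hP
  · simpa using hboundary (a, b) (0, 1) (by simp [InBox]) (by simp) hab hP
  · simpa [sub_eq_add_neg] using hboundary (a, b) (0, -1) (by simp [InBox]) (by simp) hab hP

variable [DiscreteTopology A] [Finite A] {X : Set (Config A)}

/-- In a countable SFT, a configuration at level 1 has a period. -/
theorem Level1.exists_period (hX : IsSFT X) (hcount : X.Countable) {y : Config A}
    (h : Level1 X y) : ∃ v : ℤ × ℤ, v ≠ 0 ∧ shift v y = y := by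
  by_contra! hper
  have hcl := hX.isClosed
  have hinv := hX.shift_mem
  have hy := h.1
  have hbelow : ∀ z, Prec z y → ∃ M, BiPeriodic M z := fun z hz =>
    (h.2.2 z (Preceq.mem hcl hinv hy hz.1) hz).exists_biPeriodic hcl hinv hcount
  have hescape : ∀ c : ℕ → ℤ × ℤ, (∀ k : ℕ, ¬ InBox k (c k)) →
      ∀ z, ∃ K, ∀ k ≥ K, shift (c k) y ≠ z := by
    intro c hc z
    by_cases hz : ∃ a, shift a y = z
    · obtain ⟨a, rfl⟩ := hz
      refine ⟨a.1.natAbs + a.2.natAbs, fun k hk heq => hc k ?_⟩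
      have hca : c k = a := by
        by_contra hne
        refine hper (c k - a) (sub_ne_zero.2 hne) (shift_injective a ?_)
        rw [shift_shift, add_sub_cancel, heq]
      rw [hca]
      exact (inBox_natAbs a).mono (by exact_mod_cast hk)
    · exact ⟨0, fun k _ hk => hz ⟨_, hk⟩⟩
  obtain ⟨p₀, hp₀, -⟩ := exists_prec_accumulation hcl hinv hcount hy
    (fun k => ((k : ℤ) + 1, 0)) (hescape _ fun k => by simp only [InBox]; omega)
  obtain ⟨L, hL₀⟩ := hbelow p₀ hp₀
  choose c hc using preceq_iff.1 hp₀.1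
  have : Finite (orbit p₀) := hL₀.finite_orbit.to_subtype
  obtain ⟨⟨_, a, rfl⟩, hfib⟩ := Finite.exists_infinite_fiber
    (fun n => (⟨shift (-c n) p₀, -c n, rfl⟩ : orbit p₀))
  obtain ⟨p, hp⟩ : ∃ p, p = shift a p₀ := ⟨_, rfl⟩
  have hpX : p ∈ X := hp ▸ hinv _ _ (Preceq.mem hcl hinv hy hp₀.1)
  have hL : BiPeriodic L p := hp ▸ hL₀.shift a
  have hball : ∀ n : ℕ, ∃ u, ∀ d, InBox n d → y (u + d) = p (u + d) := by
    intro n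
    obtain ⟨k, hk, hnk⟩ := (Set.infinite_coe_iff.1 hfib).exists_gt n
    have hk : shift (-c k) p₀ = p := hp ▸ congrArg Subtype.val hk
    refine ⟨c k, fun d hd => ?_⟩
    rw [← hk, add_comm, hc k d (hd.mono (by omega)), shift, add_neg_cancel_right]
  have hfin : ∃ R, (cornerDefects y p R).Finite := by
    by_contra! hinf
    have hex : ∀ R : ℕ, ∃ u ∈ cornerDefects y p R, ¬ InBox R u := fun R => by
      by_contra! hsub
      exact hinf R ((finite_inBox R).subset hsub)
    choose u hu hout using hex
    obtain ⟨z, hz, hacc⟩ := exists_prec_accumulation hcl hinv hcount hy u (hescape u hout)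
    obtain ⟨M, hM⟩ := hbelow z hz
    obtain ⟨q, hq⟩ := Int.eq_ofNat_of_zero_le (mul_pos hL.1 hM.1).le
    have hqpos := mul_pos hL.1 hM.1
    obtain ⟨k, hk, hagree⟩ := hacc q q
    obtain ⟨hne, s, t, hs, ht, hdiag⟩ := hu k
    refine hne ?_
    have h₁ := hagree 0 (by simp [InBox])
    have h₂ := hagree (s * q, t * q) (by
      rcases hs with rfl | rfl <;> rcases ht with rfl | rfl <;> simp [InBox])
    have h₃ := hdiag q (by omega) (by omega)
    have h₄ : p (u k + (s * q, t * q)) = p (u k) := by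
      rw [← hL.apply_add (M * s) (M * t) (u k), ← hq]
      congr 3 <;> ring
    have h₅ : z (s * q, t * q) = z 0 := by
      rw [← hM.apply_add (L * s) (L * t) 0, zero_add, ← hq]
      congr 2 <;> ring
    rw [zero_add] at h₁
    rw [h₁, ← h₅, ← h₂, add_comm, h₃, h₄]
  obtain ⟨R, hR⟩ := hfin
  obtain ⟨K, hK⟩ := exists_eq_off_inBox hR hball
  have hyp := eq_of_eq_off_inBox hX hcount hpX hy hL K hK
  refine hper (L, 0) ?_ (shift_eq_self_iff.2 (hyp ▸ hL.2.1))
  simpa using hL.1.ne'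

end NoPeriod

section LocalPeriod

/-- `y` has period `v` inside the square of radius `n` around `u`. -/
def LocalPeriod {A : Type*} (n : ℤ) (y : Config A) (u v : ℤ × ℤ) : Prop :=
  ∀ d, InBox n d → y (u + d + v) = y (u + d)

theorem LocalPeriod.mono {A : Type*} {m n : ℤ} (h : m ≤ n) {y : Config A} {u v : ℤ × ℤ}
    (hv : LocalPeriod n y u v) : LocalPeriod m y u v :=
  fun d hd => hv d (hd.mono h)

theorem LocalPeriod.apply_add_zsmul {A : Type*} {n m c B : ℤ} {y : Config A} {u v d : ℤ × ℤ}
    (h : LocalPeriod n y u v) (hv : InBox B v) (hd : InBox m d) (hn : m + c * B ≤ n) (k : ℤ)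
    (hk : |k| ≤ c) : y (u + d + k • v) = y (u + d) := by
  have step : ∀ j : ℤ, |j| ≤ c → y (u + d + (j + 1) • v) = y (u + d + j • v) := fun j hj => by
    have := h (d + j • v) ((hd.add (hv.smul hj)).mono hn)
    rwa [← add_assoc, add_assoc _ _ v, ← add_one_zsmul] at this
  induction k using Int.induction_on with
  | zero => simp
  | succ k ih =>
    have hk' : |(k : ℤ)| ≤ c := by rw [abs_le] at *; omega
    rw [step k hk', ih hk']
  | pred k ih =>
    have hk' : |(-k : ℤ)| ≤ c := by rw [abs_le] at *; omega
    rw [← step _ hk, sub_add_cancel, ih hk']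

theorem zsmul_eq_cross (v w e : ℤ × ℤ) : cross v w • e = cross e w • v + cross v e • w := by
  ext <;> simp [cross_apply] <;> ring

/-- Two independent local periods generate a local period in any given direction. -/
theorem LocalPeriod.apply_add_of_cross_dvd {A : Type*} {n B M : ℤ} {y : Config A}
    {u v w e : ℤ × ℤ} (hv : LocalPeriod n y u v) (hw : LocalPeriod n y u w) (hvB : InBox B v)
    (hwB : InBox B w) (he : |e.1| + |e.2| ≤ 1) (hM : 0 < M) (hdvd : cross v w ∣ M)
    (hn : M * B * B + M * B * B ≤ n) : y (u + M • e) = y u := by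
  obtain ⟨t, ht⟩ := hdvd
  have hB : 0 ≤ B := by have := hvB.1; omega
  have htM : |t| ≤ M := by
    have := Int.le_of_dvd hM ((abs_dvd _ _).2 (Dvd.intro_left _ ht.symm))
    exact this
  have hew : |cross e w| ≤ B := (abs_cross_le hwB).trans (by nlinarith)
  have hve : |cross v e| ≤ B := by
    have : cross v e = -cross e v := by simp only [cross_apply]; ring
    rw [this, abs_neg]
    exact (abs_cross_le hvB).trans (by nlinarith)
  have hα : |t * cross e w| ≤ M * B := by
    rw [abs_mul]; exact mul_le_mul htM hew (abs_nonneg _) hM.le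
  have hβ : |t * cross v e| ≤ M * B := by
    rw [abs_mul]; exact mul_le_mul htM hve (abs_nonneg _) hM.le
  have hMB : 0 ≤ M * B * B := by positivity
  have h₁ := hv.apply_add_zsmul hvB (m := 0) (d := 0) (by simp [InBox]) (by linarith) _ hα
  have h₂ := hw.apply_add_zsmul hwB (hvB.smul hα) hn _ hβ
  rw [add_zero] at h₁
  rw [← h₁, ← h₂]
  congr 1
  rw [ht, mul_comm, mul_smul, zsmul_eq_cross, smul_add, mul_smul, mul_smul, add_assoc]

theorem BiPeriodic.period_of_localPeriod {A : Type*} {n M : ℤ} {y : Config A} {v : ℤ × ℤ}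
    (h : BiPeriodic M y) (hn : M ≤ n) (hv : LocalPeriod n y 0 v) (u : ℤ × ℤ) :
    y (u + v) = y u := by
  have hu : u = (u.1 % M, u.2 % M) + (M * (u.1 / M), M * (u.2 / M)) := by
    ext <;> simp [Int.emod_add_mul_ediv]
  have hbox : InBox n (u.1 % M, u.2 % M) := by
    have := Int.emod_nonneg u.1 h.1.ne'
    have := Int.emod_nonneg u.2 h.1.ne'
    have := Int.emod_lt_of_pos u.1 h.1
    have := Int.emod_lt_of_pos u.2 h.1
    simp only [InBox]; omega
  have := hv _ hbox
  rw [zero_add] at this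
  conv_lhs => rw [hu]
  conv_rhs => rw [hu]
  rw [add_right_comm, h.apply_add, h.apply_add, this]

/-- Nonzero vectors spanning pairwise distinct lines. -/
def PairwiseNonparallel (V : Finset (ℤ × ℤ)) : Prop :=
  (∀ v ∈ V, v ≠ 0) ∧ ∀ v ∈ V, ∀ w ∈ V, cross v w = 0 → v = w

/-- If around every point of a line of direction `v` there is a large square with period `v`, and
every point has some local period in `V`, then `v` is a period. -/
theorem period_of_localPeriod_line {A : Type*} {V : Finset (ℤ × ℤ)} (hV : PairwiseNonparallel V)
    {n B C : ℤ} (hB : ∀ v ∈ V, InBox B v) (hC : ∀ v ∈ V, ∀ w ∈ V, |cross v w| ≤ C)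
    {y : Config A} (hy : ∀ u, ∃ v ∈ V, LocalPeriod n y u v) {v : ℤ × ℤ} (hv : v ∈ V)
    (hnB : B + B ≤ n) (hn : dot v v + C ≤ n) {u₀ : ℤ × ℤ}
    (hline : ∀ k : ℤ, LocalPeriod n y (u₀ + k • v) v) (u : ℤ × ℤ) : y (u + v) = y u := by
  have hB₀ : 0 ≤ B := by have := (hB v hv).1; omega
  induction hN : (cross v (u - u₀)).natAbs using Nat.strong_induction_on generalizing u with
  | _ N ih =>
  by_cases hclose : |cross v (u - u₀)| ≤ C
  · obtain ⟨k, hk⟩ := exists_sub_zsmul_inBox (hV.1 v hv) hclose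
    have := hline k _ (hk.mono hn)
    rwa [add_add_sub_cancel, add_sub_cancel] at this
  obtain ⟨w, hw, hwy⟩ := hy u
  by_cases hwv : w = v
  · simpa [hwv] using hwy 0 (by simp only [InBox, Prod.fst_zero, Prod.snd_zero]; omega)
  have hcross : cross v w ≠ 0 := fun h => hwv (hV.2 v hv w hw h).symm
  have hle := hC v hv w hw
  have hvB := hB v hv
  have hwB := hB w hw
  have hplus : ∀ d, InBox (B + B) d → y (u + d + w) = y (u + d) := fun d hd => hwy d (hd.mono hnB)
  have hsmall : (cross v (u + w - u₀)).natAbs < N ∨ (cross v (u - w - u₀)).natAbs < N := by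
    rw [show u + w - u₀ = u - u₀ + w by abel, show u - w - u₀ = u - u₀ - w by abel,
      map_add (cross v) (u - u₀), map_sub (cross v) (u - u₀)]
    generalize cross v (u - u₀) = a at *
    generalize cross v w = b at *
    rw [abs_le] at hle hclose
    omega
  rcases hsmall with hlt | hlt
  · have h₁ := ih _ hlt _ rfl
    have h₂ := hplus v (hvB.mono (by omega))
    have h₃ := hplus 0 (by simp only [InBox, Prod.fst_zero, Prod.snd_zero]; omega)
    rw [add_zero] at h₃
    rw [← h₂, add_right_comm, h₁, h₃]
  · have h₁ := ih _ hlt _ rfl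
    have h₂ := hplus (v - w) (by rw [sub_eq_add_neg]; exact hvB.add hwB.neg)
    have h₃ := hplus (-w) (hwB.neg.mono (by omega))
    rw [neg_add_cancel_right] at h₃
    rw [add_assoc, sub_add_cancel] at h₂
    rw [h₂, h₃, ← sub_eq_add_neg, ← h₁]
    congr 1
    abel

/-- If every translate of `y` has a local period from `V`, on large enough squares, then `y` has a
period from `V`. -/
theorem PairwiseNonparallel.exists_radius {V : Finset (ℤ × ℤ)} (hV : PairwiseNonparallel V) :
    ∃ n : ℕ, ∀ {A : Type*} (y : Config A), (∀ u, ∃ v ∈ V, LocalPeriod n y u v) →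
      ∃ v ∈ V, ∀ u, y (u + v) = y u := by
  obtain ⟨B, hB⟩ := exists_inBox_of_finite V.finite_toSet
  simp only [Finset.mem_coe] at hB
  have hnorm : ∀ v ∈ V, |v.1| ≤ B ∧ |v.2| ≤ B := fun v hv =>
    ⟨abs_le.2 (hB v hv).1, abs_le.2 (hB v hv).2⟩
  have hC : ∀ v ∈ V, ∀ w ∈ V, |cross v w| ≤ 2 * B * B := fun v hv w hw =>
    (abs_cross_le (hB w hw)).trans (by nlinarith [hnorm v hv])
  have hdot : ∀ v ∈ V, dot v v ≤ 2 * B * B := fun v hv => by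
    have := hnorm v hv
    have h₁ := abs_mul_abs_self v.1
    have h₂ := abs_mul_abs_self v.2
    have h₃ := mul_self_le_mul_self (abs_nonneg _) this.1
    have h₄ := mul_self_le_mul_self (abs_nonneg _) this.2
    simp only [dot]
    linarith
  obtain ⟨M, hM, hdvd⟩ : ∃ M : ℕ, 0 < M ∧
      ∀ v ∈ V, ∀ w ∈ V, cross v w ≠ 0 → cross v w ∣ (M : ℤ) := by
    refine ⟨(2 * B * B).factorial, Nat.factorial_pos _, fun v hv w hw h => ?_⟩
    refine Int.natAbs_dvd.1 (Int.natCast_dvd_natCast.2 (Nat.dvd_factorial (by omega) ?_))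
    have := hC v hv w hw
    rw [Int.abs_eq_natAbs] at this
    exact_mod_cast this
  obtain ⟨n₁, hn₁⟩ : ∃ n₁ : ℕ, n₁ = M * B * B + M * B * B := ⟨_, rfl⟩
  refine ⟨n₁ + 2 * B + 2 * (2 * B * B) + M, fun y hy => ?_⟩
  obtain ⟨n, hn⟩ : ∃ n : ℤ, n = ((n₁ + 2 * B + 2 * (2 * B * B) + M : ℕ) : ℤ) := ⟨_, rfl⟩
  rw [← hn] at hy
  push_cast at hn
  have hBB : (0 : ℤ) ≤ 2 * B * B := by positivity
  by_cases hcase : ∀ u, ∀ v ∈ V, ∃ w ∈ V, w ≠ v ∧ LocalPeriod n₁ y u w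
  · have hbi : ∀ e : ℤ × ℤ, |e.1| + |e.2| ≤ 1 → ∀ u, y (u + (M : ℤ) • e) = y u := by
      intro e he u
      obtain ⟨v, hv, hvy⟩ := hy u
      obtain ⟨w, hw, hwv, hwy⟩ := hcase u v hv
      exact (hvy.mono (by omega)).apply_add_of_cross_dvd hwy (hB v hv) (hB w hw) he
        (by exact_mod_cast hM) (hdvd v hv w hw fun h => hwv (hV.2 v hv w hw h).symm)
        (by exact_mod_cast hn₁.ge)
    have hper : BiPeriodic M y := ⟨by exact_mod_cast hM,
      by simpa using hbi (1, 0) (by simp), by simpa using hbi (0, 1) (by simp)⟩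
    obtain ⟨v, hv, hvy⟩ := hy 0
    exact ⟨v, hv, hper.period_of_localPeriod (by omega) hvy⟩
  · push Not at hcase
    obtain ⟨u₀, v, hv, hS⟩ := hcase
    have hvB := hB v hv
    have hfree : ∀ u, (∀ w ∈ V, w ≠ v → ¬ LocalPeriod n₁ y u w) → LocalPeriod n y u v := by
      intro u hu
      obtain ⟨w, hw, hwy⟩ := hy u
      by_cases hwv : w = v
      · rwa [← hwv]
      · exact absurd (hwy.mono (by omega)) (hu w hw hwv)
    have hall : ∀ k : ℤ, ∀ w ∈ V, w ≠ v → ¬ LocalPeriod n₁ y (u₀ + k • v) w := by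
      intro k
      induction k using Int.induction_on with
      | zero => simpa using hS
      | succ k ih =>
        intro w hw hwv hloc
        refine ih w hw hwv fun d hd => ?_
        have h₁ := hfree _ ih d (hd.mono (by omega))
        have h₂ := hfree _ ih (d + w) ((hd.add (hB w hw)).mono (by omega))
        rw [add_assoc, ← h₂, ← h₁]
        convert hloc d hd using 2 <;> rw [add_smul, one_smul] <;> abel
      | pred k ih =>
        intro w hw hwv hloc
        refine ih w hw hwv fun d hd => ?_
        have h₁ := hfree _ ih (d - v)
          (by rw [sub_eq_add_neg]; exact (hd.add hvB.neg).mono (by omega))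
        have h₂ := hfree _ ih (d + w - v)
          (by rw [sub_eq_add_neg]; exact ((hd.add (hB w hw)).add hvB.neg).mono (by omega))
        rw [add_assoc, sub_add_cancel] at h₁ h₂
        rw [add_assoc, h₂, h₁]
        convert hloc d hd using 2 <;> rw [sub_smul, one_smul] <;> abel
    exact ⟨v, hv, period_of_localPeriod_line hV hB hC hy hv (by omega)
      (by have := hdot v hv; omega) fun k => hfree _ (hall k)⟩

theorem dot_smul_eq_of_cross_eq_zero {v w : ℤ × ℤ} (h : cross v w = 0) :
    dot v w • v = dot v v • w := by
  rw [cross_apply] at h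
  ext
  · simp only [dot, Prod.smul_fst, smul_eq_mul]; linear_combination v.2 * h
  · simp only [dot, Prod.smul_snd, smul_eq_mul]; linear_combination -v.1 * h

theorem PairwiseNonparallel.exists_insert {V : Finset (ℤ × ℤ)} (hV : PairwiseNonparallel V)
    {v : ℤ × ℤ} (hv : v ≠ 0) :
    ∃ V', PairwiseNonparallel V' ∧ ∀ {A : Type*} (y : Config A),
      ((∃ w ∈ V, shift w y = y) ∨ shift v y = y) → ∃ w ∈ V', shift w y = y := by
  have hcomm : ∀ a b : ℤ × ℤ, cross a b = -cross b a := fun a b => by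
    simp only [cross_apply]; ring
  have hinsert : ∀ (t : ℤ × ℤ) (W : Finset (ℤ × ℤ)), t ≠ 0 → PairwiseNonparallel W →
      (∀ w ∈ W, cross t w ≠ 0) → PairwiseNonparallel (insert t W) := by
    intro t W ht hW htW
    refine ⟨fun w hw => ?_, fun a ha b hb hab => ?_⟩
    · rcases Finset.mem_insert.1 hw with rfl | hw
      exacts [ht, hW.1 w hw]
    · rcases Finset.mem_insert.1 ha with rfl | haW <;>
        rcases Finset.mem_insert.1 hb with rfl | hbW
      · rfl
      · exact absurd hab (htW b hbW)
      · rw [hcomm, neg_eq_zero] at hab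
        exact absurd hab (htW a haW)
      · exact hW.2 a haW b hbW hab
  by_cases h : ∃ v' ∈ V, cross v v' = 0
  · obtain ⟨v', hv', hcross⟩ := h
    have hpos := dot_self_pos hv
    refine ⟨insert (dot v v • v') (V.erase v'), hinsert _ _
      (smul_ne_zero hpos.ne' (hV.1 v' hv')) ⟨fun w hw => hV.1 w (Finset.mem_of_mem_erase hw),
        fun a ha b hb => hV.2 a (Finset.mem_of_mem_erase ha) b (Finset.mem_of_mem_erase hb)⟩ ?_,
      ?_⟩
    · intro w hw hzero
      have : dot v v * cross v' w = 0 := by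
        rw [← hzero]; simp only [cross_apply, Prod.smul_fst, Prod.smul_snd, smul_eq_mul]; ring
      exact Finset.ne_of_mem_erase hw (hV.2 v' hv' w (Finset.mem_of_mem_erase hw)
        ((mul_eq_zero.1 this).resolve_left hpos.ne')).symm
    · rintro A y (⟨w, hw, hwy⟩ | hvy)
      · by_cases hwv : w = v'
        · subst hwv
          exact ⟨_, Finset.mem_insert_self _ _,
            shift_eq_self_iff.2 (apply_add_zsmul (shift_eq_self_iff.1 hwy) _)⟩
        · exact ⟨w, Finset.mem_insert_of_mem (Finset.mem_erase.2 ⟨hwv, hw⟩), hwy⟩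
      · refine ⟨_, Finset.mem_insert_self _ _, ?_⟩
        rw [← dot_smul_eq_of_cross_eq_zero hcross]
        exact shift_eq_self_iff.2 (apply_add_zsmul (shift_eq_self_iff.1 hvy) _)
  · push Not at h
    refine ⟨insert v V, hinsert v V hv hV h, ?_⟩
    rintro A y (⟨w, hw, hwy⟩ | hvy)
    exacts [⟨w, Finset.mem_insert_of_mem hw, hwy⟩, ⟨v, Finset.mem_insert_self _ _, hvy⟩]

end LocalPeriod

section Main

variable [DiscreteTopology A]

/-- Closed shift-invariant subsets of `X` not covered by the configurations having a period in a
prescribed finite set of pairwise nonparallel vectors. -/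
def aperiodicSubsets (X : Set (Config A)) : Set (Set (Config A)) :=
  {Y | Y ⊆ X ∧ IsClosed Y ∧ (∀ v, ∀ y ∈ Y, shift v y ∈ Y) ∧
    ∀ V, PairwiseNonparallel V → ∃ y ∈ Y, ∀ v ∈ V, shift v y ≠ y}

theorem isClosed_forall_exists_ne (V : Finset (ℤ × ℤ)) (n : ℤ) :
    IsClosed {y : Config A | ∀ v ∈ V, ∃ d, InBox n d ∧ y (d + v) ≠ y d} := by
  have : {y : Config A | ∀ v ∈ V, ∃ d, InBox n d ∧ y (d + v) ≠ y d} =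
      ⋂ v ∈ V, ⋃ d ∈ {d | InBox n d}, {y : Config A | y (d + v) ≠ y d} := by
    ext; simp
  rw [this]
  refine isClosed_biInter fun v _ => (finite_inBox n).isClosed_biUnion fun d _ => ?_
  exact (isClosed_discrete {p : A × A | p.1 ≠ p.2}).preimage
    (f := fun y : Config A => (y (d + v), y d)) (by fun_prop)

theorem sInter_mem_aperiodicSubsets [Finite A] {X : Set (Config A)} {c : Set (Set (Config A))}
    (hc : c ⊆ aperiodicSubsets X) (hchain : IsChain (· ⊆ ·) c) (hne : c.Nonempty) :
    ⋂₀ c ∈ aperiodicSubsets X := by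
  obtain ⟨Y₀, hY₀⟩ := hne
  refine ⟨(Set.sInter_subset_of_mem hY₀).trans (hc hY₀).1,
    isClosed_sInter fun Y hY => (hc hY).2.1,
    fun v y hy Y hY => (hc hY).2.2.1 v y (hy Y hY), fun V hV => ?_⟩
  obtain ⟨n, hn⟩ := hV.exists_radius
  have : Nonempty c := ⟨⟨Y₀, hY₀⟩⟩
  have hT := isClosed_forall_exists_ne (A := A) V n
  obtain ⟨y, hy⟩ := IsCompact.nonempty_iInter_of_directed_nonempty_isCompact_isClosed
    (fun Y : c => Y.1 ∩ {y : Config A | ∀ v ∈ V, ∃ d, InBox n d ∧ y (d + v) ≠ y d})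
    (fun Y Z => by
      rcases hchain.total Y.2 Z.2 with h | h
      exacts [⟨Y, subset_rfl, Set.inter_subset_inter_left _ h⟩,
        ⟨Z, Set.inter_subset_inter_left _ h, subset_rfl⟩])
    (fun Y => by
      obtain ⟨y, hyY, hy⟩ := (hc Y.2).2.2.2 V hV
      have hu : ∃ u, ∀ v ∈ V, ¬ LocalPeriod n y u v := by
        by_contra! h
        obtain ⟨v, hv, hvy⟩ := hn y h
        exact hy v hv (shift_eq_self_iff.2 hvy)
      obtain ⟨u, hu⟩ := hu
      refine ⟨shift u y, (hc Y.2).2.2.1 u y hyY, fun v hv => ?_⟩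
      have := hu v hv
      unfold LocalPeriod at this
      push Not at this
      obtain ⟨d, hd, hne⟩ := this
      refine ⟨d, hd, ?_⟩
      rwa [shift, shift, add_comm d u, add_right_comm, add_comm d u])
    (fun Y => ((hc Y.2).2.1.inter hT).isCompact) (fun Y => (hc Y.2).2.1.inter hT)
  simp only [Set.mem_iInter, Subtype.forall] at hy
  refine ⟨y, fun Y hY => (hy Y hY).1, fun v hv hvy => ?_⟩
  obtain ⟨d, -, hd⟩ := (hy Y₀ hY₀).2 v hv
  exact hd (shift_eq_self_iff.1 hvy d)

/-- A countable subshift containing a configuration without period contains one all of whose strict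
predecessors have a period. -/
theorem exists_minimal_aperiodic [Finite A] {X : Set (Config A)} (hcl : IsClosed X)
    (hinv : ∀ v, ∀ x ∈ X, shift v x ∈ X) (hcount : X.Countable)
    (hX : ∃ x ∈ X, ∀ v : ℤ × ℤ, v ≠ 0 → shift v x ≠ x) :
    ∃ y ∈ X, (∀ v : ℤ × ℤ, v ≠ 0 → shift v y ≠ y) ∧
      ∀ z, Prec z y → ∃ v : ℤ × ℤ, v ≠ 0 ∧ shift v z = z := by
  obtain ⟨x, hx, hxper⟩ := hX
  have hXmem : X ∈ aperiodicSubsets X :=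
    ⟨subset_rfl, hcl, hinv, fun V hV => ⟨x, hx, fun v hv => hxper v (hV.1 v hv)⟩⟩
  obtain ⟨Y, hY⟩ := zorn_superset (aperiodicSubsets X) fun c hc hchain => by
    rcases c.eq_empty_or_nonempty with rfl | hne
    · exact ⟨X, hXmem, by simp⟩
    · exact ⟨_, sInter_mem_aperiodicSubsets hc hchain hne,
        fun Y hY => Set.sInter_subset_of_mem hY⟩
  obtain ⟨hYX, hYcl, hYinv, hYper⟩ := hY.prop
  have hempty : PairwiseNonparallel ∅ := ⟨by simp, by simp⟩
  have hYne : Y.Nonempty := (hYper ∅ hempty).imp fun y hy => hy.1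
  obtain ⟨y, hyY, n, hn⟩ := exists_isolated hYcl (hcount.mono hYX) hYne
  have hdiff : IsClosed (Y \ orbit y) := by
    refine isClosed_of_closure_subset fun z hz => ⟨?_, ?_⟩
    · exact closure_minimal Set.sdiff_subset hYcl hz
    · rintro ⟨c, rfl⟩
      obtain ⟨w, hw, hwz⟩ := mem_closure_iff_inBox.1 hz (n + (c.1.natAbs + c.2.natAbs))
      refine hw.2 ⟨c, ?_⟩
      have : shift (-c) w = y := hn _ (hYinv _ _ hw.1) fun u hu => by
        have := hwz (u + -c) (by exact_mod_cast hu.add (inBox_natAbs c).neg)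
        simpa only [shift, neg_add_cancel_right] using this
      simp only [← this, shift_shift, add_neg_cancel, shift_zero]
  have hdiffInv : ∀ v, ∀ z ∈ Y \ orbit y, shift v z ∈ Y \ orbit y := by
    rintro v z ⟨hz, hzy⟩
    refine ⟨hYinv v z hz, ?_⟩
    rintro ⟨c, hc⟩
    refine hzy ⟨-v + c, ?_⟩
    simp only at hc
    simp only [← shift_shift, hc]
    rw [shift_shift, neg_add_cancel, shift_zero]
  obtain ⟨V, hV, hVper⟩ : ∃ V, PairwiseNonparallel V ∧
      ∀ z ∈ Y \ orbit y, ∃ v ∈ V, shift v z = z := by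
    by_contra! h
    have := hY.le_of_le ⟨Set.sdiff_subset.trans hYX, hdiff, hdiffInv, h⟩ Set.sdiff_subset
    exact (this hyY).2 ⟨0, shift_zero y⟩
  refine ⟨y, hYX hyY, fun v hv hvy => ?_, fun z hz => ?_⟩
  · obtain ⟨V', hV', hVV'⟩ := hV.exists_insert hv
    obtain ⟨z, hz, hzper⟩ := hYper V' hV'
    obtain ⟨w, hw, hwz⟩ := hVV' z <| by
      by_cases hzy : z ∈ orbit y
      · obtain ⟨c, rfl⟩ := hzy
        exact Or.inr (by simp only [shift_shift, add_comm v c]; rw [← shift_shift, hvy])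
      · exact Or.inl (hVper z ⟨hz, hzy⟩)
    exact hzper w hw hwz
  · obtain ⟨v, hv, hvz⟩ := hVper z ⟨Preceq.mem hYcl hYinv hyY hz.1,
      ((prec_iff hcl hinv hcount (hYX hyY)).1 hz).2⟩
    exact ⟨v, hV.1 v hv, hvz⟩

end Main

theorem stmt15 {A : Type*} [Fintype A] [Nonempty A] [TopologicalSpace A] [DiscreteTopology A]
    (X : Set (Config A)) (hX : IsSFT X) (hcount : X.Countable) :
    (∃ x ∈ X, ∀ v : ℤ × ℤ, v ≠ 0 → shift v x ≠ x) ↔ ∃ x, Level2 X x := by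
  constructor
  · intro h
    obtain ⟨y, hy, hper, hbelow⟩ := exists_minimal_aperiodic hX.isClosed hX.shift_mem hcount h
    refine ⟨y, hy, fun h0 => ?_, fun h1 => ?_, fun z hz hzy => ?_⟩
    · obtain ⟨k, hk, hky⟩ := h0.exists_period hX.isClosed hX.shift_mem hcount (1, 0)
      exact hper _ (smul_ne_zero hk.ne' (by simp)) (shift_eq_self_iff.2 hky)
    · obtain ⟨v, hv, hvy⟩ := h1.exists_period hX hcount
      exact hper v hv hvy
    · obtain ⟨v, hv, hvz⟩ := hbelow z hzy
      exact level0_or_level1_of_period hX hcount hz hv hvz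
  · rintro ⟨x, hx, h0, h1, -⟩
    exact ⟨x, hx, fun v hv hvx => (level0_or_level1_of_period hX hcount hx hv hvx).elim h0 h1⟩

end CountableSubshift
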